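/- arXiv:2302.11051 — 3 statements merged into one kernel-verified Lean document; each statement's English description precedes it below -/
import Mathlib

section
/- Stationarity of the cluster point (Theorem 1, part ii). Assume 0 < η_g < 1/(2L), that the gradients are uniformly bounded (there is B > 0 with ‖∇f_i(w)‖ ≤ B for all i and all w ∈ ℝ^d), that the losses are uniformly bounded below (there is f_low ∈ ℝ with f_i(w) ≥ f_low for all i, w), and that a cluster point exists along the subsequence (t^j). Then the cluster point w* is a stationary point of the regularized global problem: −(1/M)Σ_{i=1}^M ∇f_i(w*) ∈ ∂R(w*), i.e. 0 ∈ (1/M)Σ_{i=1}^M ∇f_i(w*) + ∂R(w*). -/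
open Filter Topology Finset MeasureTheory RealInnerProductSpace

noncomputable section

abbrev Vec (d : ℕ) := EuclideanSpace ℝ (Fin d)

def subgrad {d : ℕ} (R : Vec d → ℝ) (x : Vec d) : Set (Vec d) :=
  {g | ∀ y, R x + ⟪g, y - x⟫ ≤ R y}

section InnerProductSpace

variable {E : Type*} [NormedAddCommGroup E] [InnerProductSpace ℝ E]

theorem le_add_inner_add_sq_of_lipschitz_gradient [CompleteSpace E] {f : E → ℝ} {f' : E → E}
    {L : ℝ} (hf : ∀ x, HasGradientAt f (f' x) x)
    (hlip : ∀ x y, ‖f' x - f' y‖ ≤ L * ‖x - y‖) (x y : E) :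
    f y ≤ f x + ⟪f' x, y - x⟫ + L / 2 * ‖y - x‖ ^ 2 := by
  set h := y - x with hh
  have hderiv : ∀ s : ℝ, HasDerivAt
      (fun s : ℝ => f (x + s • h) - (s * ⟪f' x, h⟫ + s ^ 2 * (L / 2 * ‖h‖ ^ 2)))
      (⟪f' (x + s • h), h⟫ - (⟪f' x, h⟫ + 2 * s * (L / 2 * ‖h‖ ^ 2))) s := by
    intro s
    have hline : HasDerivAt (fun s : ℝ => x + s • h) h s := by
      simpa using ((hasDerivAt_id s).smul_const h).const_add x
    have hcomp : HasDerivAt (fun s : ℝ => f (x + s • h)) ⟪f' (x + s • h), h⟫ s := by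
      simpa [Function.comp_def] using (hf (x + s • h)).hasFDerivAt.comp_hasDerivAt s hline
    have hquad : HasDerivAt (fun s : ℝ => s * ⟪f' x, h⟫ + s ^ 2 * (L / 2 * ‖h‖ ^ 2))
        (⟪f' x, h⟫ + 2 * s * (L / 2 * ‖h‖ ^ 2)) s := by
      simpa using ((hasDerivAt_id s).mul_const ⟪f' x, h⟫).fun_add
        ((hasDerivAt_pow 2 s).mul_const (L / 2 * ‖h‖ ^ 2))
    exact hcomp.fun_sub hquad
  have hanti : AntitoneOn
      (fun s : ℝ => f (x + s • h) - (s * ⟪f' x, h⟫ + s ^ 2 * (L / 2 * ‖h‖ ^ 2)))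
      (Set.Ici 0) := by
    refine antitoneOn_of_deriv_nonpos (convex_Ici 0)
      (fun s _ => (hderiv s).continuousAt.continuousWithinAt)
      (fun s _ => (hderiv s).differentiableAt.differentiableWithinAt) fun s hs => ?_
    have hs0 : 0 < s := by simpa using hs
    rw [(hderiv s).deriv]
    have hcs := real_inner_le_norm (f' (x + s • h) - f' x) h
    have hl := hlip (x + s • h) x
    rw [add_sub_cancel_left, norm_smul, Real.norm_of_nonneg hs0.le] at hl
    rw [inner_sub_left] at hcs
    nlinarith [mul_le_mul_of_nonneg_right hl (norm_nonneg h)]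
  have h01 := hanti (Set.mem_Ici.2 le_rfl) (Set.mem_Ici.2 zero_le_one) zero_le_one
  simp only [one_smul, zero_smul, add_zero] at h01
  rw [hh, add_sub_cancel, ← hh] at h01
  linarith

theorem add_inner_sub_sq_le_of_lipschitz_gradient [CompleteSpace E] {f : E → ℝ} {f' : E → E}
    {L : ℝ} (hf : ∀ x, HasGradientAt f (f' x) x)
    (hlip : ∀ x y, ‖f' x - f' y‖ ≤ L * ‖x - y‖) (x y : E) :
    f x + ⟪f' x, y - x⟫ - L / 2 * ‖y - x‖ ^ 2 ≤ f y := by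
  have hneg : ∀ x, HasGradientAt (fun z => -f z) (-f' x) x := fun x => by
    rw [hasGradientAt_iff_hasFDerivAt, map_neg]
    exact (hf x).hasFDerivAt.neg
  have h := le_add_inner_add_sq_of_lipschitz_gradient hneg
    (fun x y => by rw [neg_sub_neg, norm_sub_rev]; exact hlip x y) x y
  rw [inner_neg_left] at h
  linarith

theorem eq_zero_of_forall_inner_add_sq_nonneg {g : E} {C : ℝ} (hC : 0 < C)
    (h : ∀ v : E, 0 ≤ ⟪g, v⟫ + C * ‖v‖ ^ 2) : g = 0 := by
  have hg := h (-((2 * C)⁻¹ • g))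
  rw [inner_neg_right, inner_smul_right, real_inner_self_eq_norm_sq, norm_neg, norm_smul,
    Real.norm_of_nonneg (by positivity), mul_pow] at hg
  have heq : -((2 * C)⁻¹ * ‖g‖ ^ 2) + C * ((2 * C)⁻¹ ^ 2 * ‖g‖ ^ 2)
      = -((4 * C)⁻¹ * ‖g‖ ^ 2) := by
    field_simp
    ring
  rw [heq] at hg
  have hpos : 0 < (4 * C)⁻¹ := by positivity
  have hsq : ‖g‖ ^ 2 = 0 := le_antisymm (by nlinarith) (sq_nonneg _)
  simpa using hsq

theorem norm_sub_sq_eq_expand (v u x : E) :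
    ‖v - x‖ ^ 2 = ‖u - x‖ ^ 2 + 2 * ⟪u - x, v - u⟫ + ‖v - u‖ ^ 2 := by
  rw [← norm_add_sq_real, sub_add_sub_cancel']

theorem dual_update_eq_gradient [CompleteSpace E] {f : E → ℝ} {f' : E → E} {L η : ℝ}
    (hL : 0 < L) (hη : 0 < η) (hf : ∀ x, HasGradientAt f (f' x) x)
    (hlip : ∀ x y, ‖f' x - f' y‖ ≤ L * ‖x - y‖) {γ w x : E}
    (hmin : ∀ v, f x - ⟪γ, x⟫ + (2 * η)⁻¹ * ‖w - x‖ ^ 2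
      ≤ f v - ⟪γ, v⟫ + (2 * η)⁻¹ * ‖w - v‖ ^ 2) :
    γ + η⁻¹ • (w - x) = f' x := by
  have hzero : f' x - (γ + η⁻¹ • (w - x)) = 0 := by
    refine eq_zero_of_forall_inner_add_sq_nonneg (C := L / 2 + (2 * η)⁻¹) (by positivity)
      fun v => ?_
    have hup := le_add_inner_add_sq_of_lipschitz_gradient hf hlip x (x + v)
    have hm := hmin (x + v)
    rw [← sub_sub w x v, norm_sub_sq_real (w - x) v, inner_add_right] at hm
    rw [add_sub_cancel_left] at hup
    rw [inner_sub_left, inner_add_left, real_inner_smul_left]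
    have : (2 * η)⁻¹ * (2 * ⟪w - x, v⟫) = η⁻¹ * ⟪w - x, v⟫ := by field_simp
    linarith
  exact (sub_eq_zero.1 hzero).symm

theorem augmented_lagrangian_client_descent [CompleteSpace E] {f : E → ℝ} {f' : E → E}
    {L η : ℝ} (hη : 0 < η) (hf : ∀ x, HasGradientAt f (f' x) x)
    (hlip : ∀ x y, ‖f' x - f' y‖ ≤ L * ‖x - y‖) {w x x' : E}
    (hupd : f' x' = f' x + η⁻¹ • (w - x')) :
    f x' + ⟪f' x', w - x'⟫ + (2 * η)⁻¹ * ‖w - x'‖ ^ 2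
        + ((2 * η)⁻¹ - L / 2 - η * L ^ 2) * ‖x' - x‖ ^ 2
      ≤ f x + ⟪f' x, w - x⟫ + (2 * η)⁻¹ * ‖w - x‖ ^ 2 := by
  have hlow := add_inner_sub_sq_le_of_lipschitz_gradient hf hlip x' x
  have hw : w - x' = η • (f' x' - f' x) := by
    rw [hupd, add_sub_cancel_left, smul_inv_smul₀ hη.ne']
  have hwx : w - x = η • (f' x' - f' x) + (x' - x) := by rw [← hw, sub_add_sub_cancel]
  have hsq : ‖f' x' - f' x‖ ^ 2 ≤ L ^ 2 * ‖x' - x‖ ^ 2 := by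
    rw [← mul_pow]
    exact pow_le_pow_left₀ (norm_nonneg _) (hlip x' x) 2
  have hinner : ⟪f' x', x - x'⟫ + ⟪f' x, w - x⟫ - ⟪f' x', w - x'⟫
      = -(η * ‖f' x' - f' x‖ ^ 2) - ⟪f' x' - f' x, x' - x⟫ := by
    rw [hwx, hw, ← neg_sub x' x, ← real_inner_self_eq_norm_sq]
    simp only [inner_add_right, inner_smul_right, inner_neg_right, inner_sub_left]
    ring
  have hnorm : (2 * η)⁻¹ * ‖w - x‖ ^ 2 - (2 * η)⁻¹ * ‖w - x'‖ ^ 2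
      = ⟪f' x' - f' x, x' - x⟫ + (2 * η)⁻¹ * ‖x' - x‖ ^ 2 := by
    rw [hwx, ← hw, norm_add_sq_real, hw, real_inner_smul_left]
    field_simp
    ring
  rw [norm_sub_rev x x'] at hlow
  nlinarith [mul_le_mul_of_nonneg_left hsq hη.le]

theorem ConvexOn.add_inner_le_of_forall_le_add_sq {R : E → ℝ} (hR : ConvexOn ℝ Set.univ R)
    {g u : E} {C : ℝ} (hmin : ∀ v, R u ≤ R v + ⟪g, v - u⟫ + C * ‖v - u‖ ^ 2) (v : E) :
    R u + ⟪-g, v - u⟫ ≤ R v := by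
  have hlim : Tendsto (fun s : ℝ => R v + ⟪g, v - u⟫ + s * (C * ‖v - u‖ ^ 2)) (𝓝[>] 0)
      (𝓝 (R v + ⟪g, v - u⟫ + 0 * (C * ‖v - u‖ ^ 2))) :=
    ((continuous_const.add (continuous_id.mul continuous_const)).tendsto 0).mono_left
      nhdsWithin_le_nhds
  have hev : ∀ᶠ s : ℝ in 𝓝[>] 0, R u ≤ R v + ⟪g, v - u⟫ + s * (C * ‖v - u‖ ^ 2) := by
    filter_upwards [Ioo_mem_nhdsGT (zero_lt_one' ℝ)] with s hs
    have hconv := hR.2 (Set.mem_univ u) (Set.mem_univ v) (sub_nonneg.2 hs.2.le) hs.1.le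
      (sub_add_cancel 1 s)
    have hpt : (1 - s) • u + s • v = u + s • (v - u) := by module
    have hm := hmin (u + s • (v - u))
    rw [add_sub_cancel_left, inner_smul_right, norm_smul, Real.norm_of_nonneg hs.1.le,
      mul_pow] at hm
    rw [hpt, smul_eq_mul, smul_eq_mul] at hconv
    refine le_of_mul_le_mul_left ?_ hs.1
    nlinarith
  have h := ge_of_tendsto hlim hev
  rw [inner_neg_left]
  linarith

theorem augmented_lagrangian_server_descent {ι : Type*} [Fintype ι] [Nonempty ι]
    {R : E → ℝ} {η : ℝ} (F : ι → ℝ) (g x : ι → E) {u v : E}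
    (hsub : R u + ⟪-((Fintype.card ι : ℝ)⁻¹ • ∑ i, (g i + η⁻¹ • (u - x i))), v - u⟫ ≤ R v) :
    R u + (Fintype.card ι : ℝ)⁻¹ * ∑ i, (F i + ⟪g i, u - x i⟫ + (2 * η)⁻¹ * ‖u - x i‖ ^ 2)
        + (2 * η)⁻¹ * ‖v - u‖ ^ 2
      ≤ R v + (Fintype.card ι : ℝ)⁻¹
        * ∑ i, (F i + ⟪g i, v - x i⟫ + (2 * η)⁻¹ * ‖v - x i‖ ^ 2) := by
  have hterm : ∀ i, F i + ⟪g i, v - x i⟫ + (2 * η)⁻¹ * ‖v - x i‖ ^ 2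
      = (F i + ⟪g i, u - x i⟫ + (2 * η)⁻¹ * ‖u - x i‖ ^ 2)
        + ⟪g i + η⁻¹ • (u - x i), v - u⟫ + (2 * η)⁻¹ * ‖v - u‖ ^ 2 := by
    intro i
    rw [norm_sub_sq_eq_expand v u (x i), ← sub_add_sub_cancel' u (x i) v, inner_add_right,
      inner_add_left, real_inner_smul_left, mul_inv]
    ring
  have hcard : (Fintype.card ι : ℝ) ≠ 0 := Nat.cast_ne_zero.2 Fintype.card_ne_zero
  rw [inner_neg_left, real_inner_smul_left, sum_inner] at hsub
  have hsum : (Fintype.card ι : ℝ)⁻¹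
        * ∑ i, (F i + ⟪g i, v - x i⟫ + (2 * η)⁻¹ * ‖v - x i‖ ^ 2)
      = (Fintype.card ι : ℝ)⁻¹ * ∑ i, (F i + ⟪g i, u - x i⟫ + (2 * η)⁻¹ * ‖u - x i‖ ^ 2)
        + (Fintype.card ι : ℝ)⁻¹ * ∑ i, ⟪g i + η⁻¹ • (u - x i), v - u⟫
        + (2 * η)⁻¹ * ‖v - u‖ ^ 2 := by
    rw [Finset.sum_congr rfl fun i _ => hterm i, Finset.sum_add_distrib,
      Finset.sum_add_distrib (g := fun i => ⟪g i + η⁻¹ • (u - x i), v - u⟫),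
      Finset.sum_const, Finset.card_univ, nsmul_eq_mul, mul_add, mul_add,
      inv_mul_cancel_left₀ hcard]
  linarith

theorem le_add_inner_add_sq_of_norm_le {F B η : ℝ} (hη : 0 < η) {g h : E} (hg : ‖g‖ ≤ B) :
    F - η / 2 * B ^ 2 ≤ F + ⟪g, h⟫ + (2 * η)⁻¹ * ‖h‖ ^ 2 := by
  have hin := neg_le_of_abs_le (abs_real_inner_le_norm g h)
  have hB := mul_le_mul_of_nonneg_right hg (norm_nonneg h)
  have hsq : 0 ≤ (2 * η)⁻¹ * (‖h‖ - η * B) ^ 2 := by positivity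
  have heq : (2 * η)⁻¹ * (‖h‖ - η * B) ^ 2
      = (2 * η)⁻¹ * ‖h‖ ^ 2 - B * ‖h‖ + η / 2 * B ^ 2 := by
    field_simp
    ring
  linarith

end InnerProductSpace

theorem tendsto_zero_of_mul_norm_sq_le {E : Type*} [NormedAddCommGroup E] {v : ℕ → E} {D : ℕ → ℝ}
    {c : ℝ} (hc : 0 < c) (hD : Tendsto D atTop (𝓝 0)) (h : ∀ t, c * ‖v t‖ ^ 2 ≤ D t) :
    Tendsto v atTop (𝓝 0) := by
  rw [tendsto_zero_iff_norm_tendsto_zero]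
  have hsq : Tendsto (fun t => ‖v t‖ ^ 2) atTop (𝓝 0) := by
    refine squeeze_zero (fun t => sq_nonneg _) (fun t => ?_) (by simpa using hD.div_const c)
    rw [le_div_iff₀ hc, mul_comm]
    exact h t
  simpa [Real.sqrt_sq (norm_nonneg _)] using hsq.sqrt

theorem tendsto_zero_of_add_le_of_bddBelow {u D : ℕ → ℝ} {b : ℝ} (hb : ∀ t, b ≤ u t)
    (hD : ∀ t, 0 ≤ D t) (h : ∀ t, u (t + 1) + D t ≤ u t) : Tendsto D atTop (𝓝 0) := by
  have hanti : Antitone u := antitone_nat_of_succ_le fun t => by linarith [h t, hD t]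
  have hlim := tendsto_atTop_ciInf hanti ⟨b, by rintro _ ⟨t, rfl⟩; exact hb t⟩
  refine squeeze_zero hD (fun t => by linarith [h t]) (?_ : Tendsto (fun t => u t - u (t + 1)) _ _)
  simpa using hlim.sub (hlim.comp (tendsto_add_atTop_nat 1))

theorem fedslr_cluster_point_stationary
    (d M : ℕ) (hd : 1 ≤ d) (hM : 1 ≤ M)
    (L ηg : ℝ) (hL : 0 < L) (hηg : 0 < ηg)
    (f : Fin M → Vec d → ℝ) (f' : Fin M → Vec d → Vec d)
    (hgrad : ∀ i x, HasGradientAt (f i) (f' i x) x)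
    (hlip : ∀ i (x y : Vec d), ‖f' i x - f' i y‖ ≤ L * ‖x - y‖)
    (R : Vec d → ℝ) (hRconv : ConvexOn ℝ Set.univ R) (hRnn : ∀ x, 0 ≤ R x)
    (w : ℕ → Vec d) (wi γi : Fin M → ℕ → Vec d)
    (hloc : ∀ i t (v : Vec d),
      f i (wi i (t+1)) - ⟪γi i t, wi i (t+1)⟫ + (2*ηg)⁻¹ * ‖w t - wi i (t+1)‖^2
        ≤ f i v - ⟪γi i t, v⟫ + (2*ηg)⁻¹ * ‖w t - v‖^2)
    (hdual : ∀ i t, γi i (t+1) = γi i t + ηg⁻¹ • (w t - wi i (t+1)))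
    (hagg : ∀ t (v : Vec d), v ≠ w (t+1) →
      R (w (t+1)) + (M:ℝ)⁻¹ * ∑ i, ⟪γi i (t+1), w (t+1)⟫
          + (2*ηg)⁻¹ * ‖w (t+1) - (M:ℝ)⁻¹ • ∑ i, wi i (t+1)‖^2
        < R v + (M:ℝ)⁻¹ * ∑ i, ⟪γi i (t+1), v⟫
          + (2*ηg)⁻¹ * ‖v - (M:ℝ)⁻¹ • ∑ i, wi i (t+1)‖^2)
    (hηg' : ηg < 1 / (2 * L))
    (B : ℝ) (hB : 0 < B) (hBgrad : ∀ i x, ‖f' i x‖ ≤ B)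
    (flow : ℝ) (hflow : ∀ i x, flow ≤ f i x)
    (ts : ℕ → ℕ) (hts : StrictMono ts) (hts1 : 1 ≤ ts 0)
    (wst : Vec d) (wist γist : Fin M → Vec d)
    (hclw : Tendsto (fun j => w (ts j)) atTop (𝓝 wst))
    (hclwi : ∀ i, Tendsto (fun j => wi i (ts j)) atTop (𝓝 (wist i)))
    (hclγ : ∀ i, Tendsto (fun j => γi i (ts j)) atTop (𝓝 (γist i)))
 :
    -((M:ℝ)⁻¹ • ∑ i, f' i wst) ∈ subgrad R wst := by
  have : Nonempty (Fin M) := ⟨⟨0, hM⟩⟩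
  have hMpos : (0 : ℝ) < M := Nat.cast_pos.2 hM
  have hγ : ∀ i t, γi i (t + 1) = f' i (wi i (t + 1)) := fun i t =>
    (hdual i t).trans
      (dual_update_eq_gradient hL hηg (hgrad i) (hlip i) (hloc i t))
  have hsub : ∀ t v, R (w (t + 1)) + ⟪-((M : ℝ)⁻¹ • ∑ i, (f' i (wi i (t + 1))
      + ηg⁻¹ • (w (t + 1) - wi i (t + 1)))), v - w (t + 1)⟫ ≤ R v := by
    intro t
    refine hRconv.add_inner_le_of_forall_le_add_sq (C := (2 * ηg)⁻¹) fun v => ?_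
    have hmin : R (w (t+1)) + (M:ℝ)⁻¹ * ∑ i, ⟪γi i (t+1), w (t+1)⟫
          + (2*ηg)⁻¹ * ‖w (t+1) - (M:ℝ)⁻¹ • ∑ i, wi i (t+1)‖^2
        ≤ R v + (M:ℝ)⁻¹ * ∑ i, ⟪γi i (t+1), v⟫
          + (2*ηg)⁻¹ * ‖v - (M:ℝ)⁻¹ • ∑ i, wi i (t+1)‖^2 := by
      by_cases hv : v = w (t + 1)
      · rw [hv]
      · exact (hagg t v hv).le
    have hmean : (M : ℝ)⁻¹ • ∑ i, (f' i (wi i (t + 1)) + ηg⁻¹ • (w (t + 1) - wi i (t + 1)))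
        = (M : ℝ)⁻¹ • ∑ i, γi i (t + 1)
          + ηg⁻¹ • (w (t + 1) - (M : ℝ)⁻¹ • ∑ i, wi i (t + 1)) := by
      simp only [hγ, Finset.sum_add_distrib, ← Finset.smul_sum, Finset.sum_sub_distrib,
        Finset.sum_const, Finset.card_univ, Fintype.card_fin, ← Nat.cast_smul_eq_nsmul ℝ]
      rw [smul_add, smul_comm (M : ℝ)⁻¹ ηg⁻¹, smul_sub (M : ℝ)⁻¹, inv_smul_smul₀ hMpos.ne']
    rw [norm_sub_sq_eq_expand v (w (t + 1))] at hmin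
    rw [hmean, inner_add_left, real_inner_smul_left, real_inner_smul_left, sum_inner]
    simp only [inner_sub_right, Finset.sum_sub_distrib] at hmin ⊢
    have hη2 : ηg⁻¹ = (2 * ηg)⁻¹ * 2 := by field_simp
    rw [hη2]
    linarith
  set c : ℝ := (2 * ηg)⁻¹ - L / 2 - ηg * L ^ 2 with hc
  have hcpos : 0 < c := by
    have hx : ηg * (2 * L) < 1 := (lt_div_iff₀ (by positivity)).1 hηg'
    have hceq : c = (2 * ηg)⁻¹ * ((1 - ηg * (2 * L)) * (1 + ηg * L)) := by
      rw [hc]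
      field_simp
      ring
    rw [hceq]
    have := sub_pos.2 hx
    positivity
  have hdesc : ∀ i t, _ := fun i t =>
    augmented_lagrangian_client_descent (w := w (t + 1)) (x := wi i (t + 1))
      (x' := wi i (t + 1 + 1)) hηg (hgrad i) (hlip i)
      (by rw [← hγ, ← hγ]; exact hdual i (t + 1))
  have hserv : ∀ t, _ := fun t =>
    augmented_lagrangian_server_descent (R := R) (η := ηg)
      (fun i => f i (wi i (t + 1 + 1))) (fun i => f' i (wi i (t + 1 + 1)))
      (fun i => wi i (t + 1 + 1)) (u := w (t + 1 + 1)) (v := w (t + 1))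
      (by rw [Fintype.card_fin]; exact hsub (t + 1) (w (t + 1)))
  simp only [Fintype.card_fin] at hserv
  set D : ℕ → ℝ := fun t => (M : ℝ)⁻¹ * ∑ i, c * ‖wi i (t + 1 + 1) - wi i (t + 1)‖ ^ 2
    + (2 * ηg)⁻¹ * ‖w (t + 1) - w (t + 1 + 1)‖ ^ 2 with hDdef
  have hD : Tendsto D atTop (𝓝 0) := by
    refine tendsto_zero_of_add_le_of_bddBelow (b := flow - ηg / 2 * B ^ 2)
      (u := fun t => R (w (t + 1)) + (M : ℝ)⁻¹ * ∑ i, (f i (wi i (t + 1))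
        + ⟪f' i (wi i (t + 1)), w (t + 1) - wi i (t + 1)⟫
        + (2 * ηg)⁻¹ * ‖w (t + 1) - wi i (t + 1)‖ ^ 2)) (fun t => ?_) (fun t => ?_) fun t => ?_
    · have hsum : ∑ _i : Fin M, (flow - ηg / 2 * B ^ 2) ≤ ∑ i, (f i (wi i (t + 1))
          + ⟪f' i (wi i (t + 1)), w (t + 1) - wi i (t + 1)⟫
          + (2 * ηg)⁻¹ * ‖w (t + 1) - wi i (t + 1)‖ ^ 2) :=
        Finset.sum_le_sum fun i _ => (sub_le_sub_right (hflow i _) _).trans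
          (le_add_inner_add_sq_of_norm_le hηg (hBgrad i _))
      have hmul := mul_le_mul_of_nonneg_left hsum (inv_nonneg.2 hMpos.le)
      rw [Finset.sum_const, Finset.card_univ, Fintype.card_fin, nsmul_eq_mul,
        inv_mul_cancel_left₀ hMpos.ne'] at hmul
      linarith [hRnn (w (t + 1))]
    · positivity
    · have hsum := mul_le_mul_of_nonneg_left
        (Finset.sum_le_sum fun i (_ : i ∈ Finset.univ) => hdesc i t) (inv_nonneg.2 hMpos.le)
      rw [Finset.sum_add_distrib, mul_add] at hsum
      have := hserv t
      simp only [hDdef]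
      linarith
  have hΔw : Tendsto (fun t => w (t + 1) - w (t + 1 + 1)) atTop (𝓝 0) := by
    refine tendsto_zero_of_mul_norm_sq_le (c := (2 * ηg)⁻¹) (by positivity) hD fun t => ?_
    exact le_add_of_nonneg_left (by positivity)
  have hΔwi : ∀ i, Tendsto (fun t => wi i (t + 1 + 1) - wi i (t + 1)) atTop (𝓝 0) := by
    intro i
    refine tendsto_zero_of_mul_norm_sq_le (c := (M : ℝ)⁻¹ * c) (by positivity) hD fun t => ?_
    refine le_add_of_le_of_nonneg ?_ (by positivity)
    rw [mul_assoc]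
    refine mul_le_mul_of_nonneg_left ?_ (by positivity)
    exact Finset.single_le_sum (f := fun i => c * ‖wi i (t + 1 + 1) - wi i (t + 1)‖ ^ 2)
      (fun j _ => by positivity) (Finset.mem_univ i)
  have hgap : ∀ i, Tendsto (fun t => w t - wi i t) atTop (𝓝 0) := by
    intro i
    have hdrift : Tendsto (fun t => w (t + 1) - wi i (t + 1 + 1)) atTop (𝓝 0) := by
      refine squeeze_zero_norm (a := fun t => ηg * (L * ‖wi i (t + 1 + 1) - wi i (t + 1)‖))
        (fun t => ?_) (by simpa using ((hΔwi i).norm.const_mul L).const_mul ηg)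
      have heq : w (t + 1) - wi i (t + 1 + 1)
          = ηg • (f' i (wi i (t + 1 + 1)) - f' i (wi i (t + 1))) := by
        rw [← hγ, ← hγ, hdual i (t + 1), add_sub_cancel_left, smul_inv_smul₀ hηg.ne']
      rw [heq, norm_smul, Real.norm_of_nonneg hηg.le]
      exact mul_le_mul_of_nonneg_left (hlip i _ _) hηg.le
    rw [← tendsto_add_atTop_iff_nat 2]
    simpa using hdrift.sub hΔw
  have hwi : ∀ i, Tendsto (fun j => wi i (ts j)) atTop (𝓝 wst) := fun i => by
    simpa using hclw.sub ((hgap i).comp hts.tendsto_atTop)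
  have hcont : ∀ i, Continuous (f' i) := fun i =>
    (LipschitzWith.of_dist_le_mul (K := L.toNNReal) fun x y => by
      simpa [dist_eq_norm, hL.le] using hlip i x y).continuous
  have hRcont : Continuous R := continuousOn_univ.1 (hRconv.continuousOn isOpen_univ)
  intro y
  have hq : Tendsto (fun j => -((M : ℝ)⁻¹ • ∑ i, (f' i (wi i (ts j))
      + ηg⁻¹ • (w (ts j) - wi i (ts j))))) atTop (𝓝 (-((M : ℝ)⁻¹ • ∑ i, f' i wst))) := by
    refine ((tendsto_finsetSum _ fun i _ => ?_).const_smul _).neg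
    simpa using (((hcont i).tendsto wst).comp (hwi i)).add
      (((hgap i).comp hts.tendsto_atTop).const_smul ηg⁻¹)
  refine le_of_tendsto (((hRcont.tendsto wst).comp hclw).add
    (hq.inner (tendsto_const_nhds.sub hclw))) (Eventually.of_forall fun j => ?_)
  obtain ⟨t, ht⟩ : ∃ t, ts j = t + 1 :=
    Nat.exists_eq_add_of_le' (hts1.trans (hts.monotone (Nat.zero_le j)))
  simpa only [Function.comp_apply, ht] using hsub t y
end
end

section
/- Global convergence of the FedSLR sequence (Theorem 2, final claim). Assume 0 < η_g < 1/(2L), uniformly bounded gradients (‖∇f_i(w)‖ ≤ B for all i, w), uniformly lower-bounded losses (f_i(w) ≥ f_low for all i, w), existence of a cluster point along a subsequence (t^j), and the KL hypothesis with exponent θ ∈ [0, 1) and constant c > 0 (i.e., for every t ≥ 1 with r_t > 0, r_t^θ ≤ c(1−θ)·dist(0, ∂D(w_t, (w_{i,t}), (γ_{i,t})))). Then Σ_{t=1}^∞ (1/M)Σ_{i=1}^M ‖w_{i,t} − w_{i,t+1}‖ < ∞; consequently the full sequences converge: w_{i,t} → w_i* and w_t → w* as t → ∞, and the limit w* is a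 stationary point of the regularized problem, i.e. −(1/M)Σ_{i=1}^M ∇f_i(w*) ∈ ∂R(w*). -/
open Filter Topology Finset MeasureTheory RealInnerProductSpace

noncomputable section

def potD {d M : ℕ} (ηg : ℝ) (f : Fin M → Vec d → ℝ) (R : Vec d → ℝ)
    (x : Vec d) (y γv : Fin M → Vec d) : ℝ :=
  (M : ℝ)⁻¹ * ∑ i, f i (y i) + R x + (M : ℝ)⁻¹ * ∑ i, ⟪γv i, x - y i⟫
    + (M : ℝ)⁻¹ * ∑ i, (2 * ηg)⁻¹ * ‖x - y i‖ ^ 2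

abbrev Tup (d M : ℕ) := PiLp 2 (fun _ : Unit ⊕ Fin M ⊕ Fin M => Vec d)

def subdiffD {d M : ℕ} (ηg : ℝ) (f' : Fin M → Vec d → Vec d) (R : Vec d → ℝ)
    (x : Vec d) (y γv : Fin M → Vec d) : Set (Tup d M) :=
  {Tp | ∃ s ∈ subgrad R x,
    Tp (Sum.inl ()) = s + (M : ℝ)⁻¹ • ∑ i, γv i + (ηg * M)⁻¹ • ∑ i, (x - y i) ∧
    (∀ i, Tp (Sum.inr (Sum.inl i)) = (M : ℝ)⁻¹ • (f' i (y i) - γv i - ηg⁻¹ • (x - y i))) ∧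
    (∀ i, Tp (Sum.inr (Sum.inr i)) = (M : ℝ)⁻¹ • (x - y i))}

/-- The quadratic lower bound for a function with Lipschitz gradient. -/
lemma lower_quadratic_bound_of_lipschitz_gradient {E : Type*} [NormedAddCommGroup E]
    [InnerProductSpace ℝ E] [CompleteSpace E] {f : E → ℝ} {f' : E → E} {L : ℝ}
    (hgrad : ∀ x, HasGradientAt f (f' x) x) (hlip : ∀ x y, ‖f' x - f' y‖ ≤ L * ‖x - y‖)
    (x y : E) : f y + ⟪f' y, x - y⟫ - L / 2 * ‖x - y‖ ^ 2 ≤ f x := by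
  set v := x - y with hv
  have hderiv : ∀ s : ℝ, HasDerivAt
      (fun s : ℝ => f (y + s • v) - s * ⟪f' y, v⟫ + L / 2 * s ^ 2 * ‖v‖ ^ 2)
      (⟪f' (y + s • v), v⟫ - ⟪f' y, v⟫ + L * s * ‖v‖ ^ 2) s := by
    intro s
    have hline : HasDerivAt (fun s : ℝ => y + s • v) v s := by
      simpa using ((hasDerivAt_id s).smul_const v).const_add y
    have hf := (hgrad (y + s • v)).hasFDerivAt.comp_hasDerivAt s hline
    have hl := (hasDerivAt_id s).mul_const (⟪f' y, v⟫)
    have hq := (((hasDerivAt_id s).pow 2).const_mul (L / 2)).mul_const (‖v‖ ^ 2)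
    refine ((hf.sub hl).add hq).congr_deriv ?_
    simp only [InnerProductSpace.toDual_apply_apply, id_eq, Nat.cast_ofNat]
    ring
  have hmono := monotoneOn_of_deriv_nonneg (convex_Icc (0 : ℝ) 1)
    (fun s _ => (hderiv s).continuousAt.continuousWithinAt)
    (fun s _ => (hderiv s).differentiableAt.differentiableWithinAt) (by
      intro s hs
      rw [interior_Icc] at hs
      rw [(hderiv s).deriv, ← inner_sub_left]
      have h1 := hlip (y + s • v) y
      rw [add_sub_cancel_left, norm_smul, Real.norm_of_nonneg hs.1.le] at h1
      have h2 := neg_le_of_abs_le (abs_real_inner_le_norm (f' (y + s • v) - f' y) v)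
      nlinarith [mul_le_mul_of_nonneg_right h1 (norm_nonneg v)])
  have h := hmono (Set.left_mem_Icc.2 zero_le_one) (Set.right_mem_Icc.2 zero_le_one) zero_le_one
  simp only [zero_smul, add_zero, one_smul, hv, add_sub_cancel] at h
  simp only [hv]
  linarith

/-- The quadratic upper bound for a function with Lipschitz gradient. -/
lemma upper_quadratic_bound_of_lipschitz_gradient {E : Type*} [NormedAddCommGroup E]
    [InnerProductSpace ℝ E] [CompleteSpace E] {f : E → ℝ} {f' : E → E} {L : ℝ}
    (hgrad : ∀ x, HasGradientAt f (f' x) x) (hlip : ∀ x y, ‖f' x - f' y‖ ≤ L * ‖x - y‖)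
    (x y : E) : f x ≤ f y + ⟪f' y, x - y⟫ + L / 2 * ‖x - y‖ ^ 2 := by
  have hneg : ∀ x, HasGradientAt (fun x => -f x) (-f' x) x := fun x => by
    rw [hasGradientAt_iff_hasFDerivAt, map_neg]
    exact (hgrad x).hasFDerivAt.neg
  have h := lower_quadratic_bound_of_lipschitz_gradient (L := L) hneg (fun x y => by
    rw [neg_sub_neg, norm_sub_rev]
    exact hlip x y) x y
  rw [inner_neg_left] at h
  linarith

lemma nonneg_of_forall_add_mul_nonneg {a b : ℝ} (h : ∀ s : ℝ, 0 < s → s ≤ 1 → 0 ≤ a + s * b) :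
    0 ≤ a := by
  have hlim : Tendsto (fun s : ℝ => a + s * b) (𝓝[>] 0) (𝓝 a) := by
    have hcont : Continuous fun s : ℝ => a + s * b := by fun_prop
    simpa using (hcont.tendsto 0).mono_left nhdsWithin_le_nhds
  refine ge_of_tendsto hlim ?_
  filter_upwards [Ioc_mem_nhdsGT (zero_lt_one' ℝ)] with s hs using h s hs.1 hs.2

lemma norm_sub_smul_sq {E : Type*} [NormedAddCommGroup E] [InnerProductSpace ℝ E]
    (u z : E) (s : ℝ) : ‖u - s • z‖ ^ 2 = ‖u‖ ^ 2 - 2 * (s * ⟪u, z⟫) + s ^ 2 * ‖z‖ ^ 2 := by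
  rw [norm_sub_sq_real, inner_smul_right, norm_smul, mul_pow, Real.norm_eq_abs, sq_abs]

/-- First-order condition for the local subproblem of a client. -/
lemma gradient_eq_of_forall_prox_le {E : Type*} [NormedAddCommGroup E]
    [InnerProductSpace ℝ E] [CompleteSpace E] {f : E → ℝ} {f' : E → E} {L η : ℝ}
    (hgrad : ∀ x, HasGradientAt f (f' x) x) (hlip : ∀ x y, ‖f' x - f' y‖ ≤ L * ‖x - y‖)
    {w y γ : E}
    (hmin : ∀ v, f y - ⟪γ, y⟫ + (2 * η)⁻¹ * ‖w - y‖ ^ 2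
      ≤ f v - ⟪γ, v⟫ + (2 * η)⁻¹ * ‖w - v‖ ^ 2) :
    f' y = γ + η⁻¹ • (w - y) := by
  have key : ∀ z, 0 ≤ ⟪f' y - (γ + η⁻¹ • (w - y)), z⟫ := by
    intro z
    refine nonneg_of_forall_add_mul_nonneg (b := (L / 2 + (2 * η)⁻¹) * ‖z‖ ^ 2) fun s hs _ => ?_
    have h1 := hmin (y + s • z)
    have h2 := upper_quadratic_bound_of_lipschitz_gradient hgrad hlip (y + s • z) y
    rw [add_sub_cancel_left, inner_smul_right, norm_smul, mul_pow, Real.norm_eq_abs, sq_abs] at h2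
    rw [← sub_sub, norm_sub_smul_sq, inner_add_right, inner_smul_right] at h1
    rw [inner_sub_left, inner_add_left, real_inner_smul_left]
    refine nonneg_of_mul_nonneg_right (?_ : 0 ≤ s * _) hs
    rw [mul_inv] at h1 ⊢
    linarith
  have h := key (-(f' y - (γ + η⁻¹ • (w - y))))
  rw [inner_neg_right, real_inner_self_eq_norm_sq] at h
  have h0 : ‖f' y - (γ + η⁻¹ • (w - y))‖ = 0 := by
    nlinarith [norm_nonneg (f' y - (γ + η⁻¹ • (w - y)))]
  exact sub_eq_zero.1 (norm_eq_zero.1 h0)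

/-- First-order condition for the proximal step on the regularizer. -/
lemma neg_mem_subgrad_of_forall_prox_le {d : ℕ} {R : Vec d → ℝ} (hR : ConvexOn ℝ Set.univ R)
    {η : ℝ} {a b x : Vec d}
    (hmin : ∀ v, R x + ⟪a, x⟫ + (2 * η)⁻¹ * ‖b - x‖ ^ 2
      ≤ R v + ⟪a, v⟫ + (2 * η)⁻¹ * ‖b - v‖ ^ 2) :
    -(a + η⁻¹ • (x - b)) ∈ subgrad R x := by
  intro y
  suffices 0 ≤ R y - R x + ⟪a + η⁻¹ • (x - b), y - x⟫ by
    rw [inner_neg_left]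
    linarith
  refine nonneg_of_forall_add_mul_nonneg (b := (2 * η)⁻¹ * ‖y - x‖ ^ 2) fun s hs hs1 => ?_
  have h1 := hmin (x + s • (y - x))
  have h2 := hR.2 (Set.mem_univ x) (Set.mem_univ y) (sub_nonneg.2 hs1) hs.le (by ring)
  rw [show (1 - s) • x + s • y = x + s • (y - x) by module, smul_eq_mul, smul_eq_mul] at h2
  rw [← sub_sub, norm_sub_smul_sq, inner_add_right, inner_smul_right] at h1
  rw [inner_add_left, real_inner_smul_left, ← neg_sub b x, inner_neg_left]
  refine nonneg_of_mul_nonneg_right (?_ : 0 ≤ s * _) hs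
  rw [mul_inv] at h1 ⊢
  linarith

/-- Decrease of the local objective between an arbitrary point and its stationary point. -/
lemma prox_add_sq_le {E : Type*} [NormedAddCommGroup E]
    [InnerProductSpace ℝ E] [CompleteSpace E] {f : E → ℝ} {f' : E → E} {L η : ℝ}
    (hgrad : ∀ x, HasGradientAt f (f' x) x) (hlip : ∀ x y, ‖f' x - f' y‖ ≤ L * ‖x - y‖)
    {w y γ : E} (hy : f' y = γ + η⁻¹ • (w - y)) (x : E) :
    f y + ⟪γ, w - y⟫ + (2 * η)⁻¹ * ‖w - y‖ ^ 2 + ((2 * η)⁻¹ - L / 2) * ‖x - y‖ ^ 2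
      ≤ f x + ⟪γ, w - x⟫ + (2 * η)⁻¹ * ‖w - x‖ ^ 2 := by
  have h := lower_quadratic_bound_of_lipschitz_gradient hgrad hlip x y
  have hn : ‖w - x‖ ^ 2 = ‖w - y‖ ^ 2 - 2 * ⟪w - y, x - y⟫ + ‖x - y‖ ^ 2 := by
    rw [← norm_sub_sq_real, sub_sub_sub_cancel_right]
  have hi : ⟪γ, w - x⟫ = ⟪γ, w - y⟫ - ⟪γ, x - y⟫ := by
    rw [← inner_sub_right, sub_sub_sub_cancel_right]
  rw [hy, inner_add_left, real_inner_smul_left] at h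
  rw [hn, hi, mul_inv]
  linarith

lemma mean_norm_sub_sq {E : Type*} [NormedAddCommGroup E] [InnerProductSpace ℝ E] {M : ℕ}
    (hM : 1 ≤ M) (x : E) (y : Fin M → E) :
    (M : ℝ)⁻¹ * ∑ i, ‖x - y i‖ ^ 2 = ‖x - (M : ℝ)⁻¹ • ∑ i, y i‖ ^ 2
      + ((M : ℝ)⁻¹ * ∑ i, ‖y i‖ ^ 2 - ‖(M : ℝ)⁻¹ • ∑ i, y i‖ ^ 2) := by
  have hM0 : (M : ℝ) ≠ 0 := by positivity
  simp only [norm_sub_sq_real, Finset.sum_add_distrib, Finset.sum_sub_distrib, inner_smul_right,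
    inner_sum, ← Finset.mul_sum, Finset.sum_const, Finset.card_univ, Fintype.card_fin,
    nsmul_eq_mul]
  field_simp
  ring

lemma potD_eq {d M : ℕ} (η : ℝ) (f : Fin M → Vec d → ℝ) (R : Vec d → ℝ)
    (x : Vec d) (y γ : Fin M → Vec d) :
    potD η f R x y γ = R x
      + (M : ℝ)⁻¹ * ∑ i, (f i (y i) + ⟪γ i, x - y i⟫ + (2 * η)⁻¹ * ‖x - y i‖ ^ 2) := by
  simp only [potD, Finset.sum_add_distrib]
  ring

/-- The server step does not increase the potential. -/
lemma potD_le_of_prox_le {d M : ℕ} (hM : 1 ≤ M) {η : ℝ} (f : Fin M → Vec d → ℝ) {R : Vec d → ℝ}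
    {x x' : Vec d} {y γ : Fin M → Vec d}
    (h : R x' + (M : ℝ)⁻¹ * ∑ i, ⟪γ i, x'⟫ + (2 * η)⁻¹ * ‖x' - (M : ℝ)⁻¹ • ∑ i, y i‖ ^ 2
      ≤ R x + (M : ℝ)⁻¹ * ∑ i, ⟪γ i, x⟫ + (2 * η)⁻¹ * ‖x - (M : ℝ)⁻¹ • ∑ i, y i‖ ^ 2) :
    potD η f R x' y γ ≤ potD η f R x y γ := by
  simp only [potD, inner_sub_right, Finset.sum_sub_distrib, ← Finset.mul_sum]
  have h1 := mean_norm_sub_sq hM x y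
  have h2 := mean_norm_sub_sq hM x' y
  rw [mul_left_comm _ (2 * η)⁻¹, mul_left_comm _ (2 * η)⁻¹, h1, h2]
  linarith

/-- Summability from sufficient decrease and the Kurdyka–Łojasiewicz inequality. -/
lemma summable_of_sq_descent_of_kl {r a : ℕ → ℝ} {θ σ K : ℝ} (hθ : 0 ≤ θ) (hθ' : θ < 1)
    (hσ : 0 < σ) (hK : 0 ≤ K) (ha : ∀ t, 0 ≤ a t) (hr : ∀ t, 0 ≤ r t)
    (hdesc : ∀ t, r (t + 1) + σ * a t ^ 2 ≤ r t)
    (hkl : ∀ t, 0 < r t → r t ^ θ ≤ K * (1 - θ) * a t) : Summable a := by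
  have hp : 0 < 1 - θ := sub_pos.2 hθ'
  have hstep : ∀ t, a t ≤ K / σ * (r t ^ (1 - θ) - r (t + 1) ^ (1 - θ)) := by
    intro t
    have hmono : r (t + 1) ^ (1 - θ) ≤ r t ^ (1 - θ) :=
      Real.rpow_le_rpow (hr _) (by nlinarith [hdesc t, sq_nonneg (a t)]) hp.le
    rcases (ha t).eq_or_lt with h0 | hapos
    · rw [← h0]
      exact mul_nonneg (by positivity) (sub_nonneg.2 hmono)
    have hrt : 0 < r t := lt_of_lt_of_le (by positivity) <|
      (le_add_of_nonneg_left (hr (t + 1))).trans (hdesc t)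
    have hyoung := Real.geom_mean_le_arith_mean2_weighted hp.le hθ (hr (t + 1)) hrt.le (by ring)
    have hprod : r t ^ (1 - θ) * r t ^ θ = r t := by
      rw [← Real.rpow_add hrt, sub_add_cancel, Real.rpow_one]
    have h1 := mul_le_mul_of_nonneg_left (hkl t hrt) (sub_nonneg.2 hmono)
    have h2 : (1 - θ) * (σ * a t ^ 2)
        ≤ (1 - θ) * ((r t ^ (1 - θ) - r (t + 1) ^ (1 - θ)) * (K * a t)) := by
      have := mul_le_mul_of_nonneg_left (hdesc t) hp.le
      linarith
    have h3 := le_of_mul_le_mul_left h2 hp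
    rw [div_mul_eq_mul_div, le_div_iff₀ hσ]
    refine le_of_mul_le_mul_right ?_ hapos
    linarith
  refine summable_of_sum_range_le (c := K / σ * r 0 ^ (1 - θ)) ha fun n => ?_
  calc ∑ t ∈ Finset.range n, a t
      ≤ ∑ t ∈ Finset.range n, K / σ * (r t ^ (1 - θ) - r (t + 1) ^ (1 - θ)) :=
        Finset.sum_le_sum fun t _ => hstep t
    _ = K / σ * (r 0 ^ (1 - θ) - r n ^ (1 - θ)) := by
        rw [← Finset.mul_sum, Finset.sum_range_sub' fun t => r t ^ (1 - θ)]
    _ ≤ K / σ * r 0 ^ (1 - θ) := by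
        gcongr
        exact sub_le_self _ (Real.rpow_nonneg (hr n) _)

/-- At a point satisfying both first-order conditions, the subdifferential of the potential
comes within a multiple of the mean disagreement of the origin. -/
lemma infDist_subdiffD_le {d M : ℕ} {η : ℝ} (hη : 0 < η)
    {f' : Fin M → Vec d → Vec d} {R : Vec d → ℝ} {x : Vec d} {y γ : Fin M → Vec d}
    (hγ : ∀ i, f' i (y i) = γ i)
    (hx : -((M : ℝ)⁻¹ • ∑ i, γ i + (η * M)⁻¹ • ∑ i, (x - y i)) ∈ subgrad R x) :
    Metric.infDist (0 : Tup d M) (subdiffD η f' R x y γ)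
      ≤ (η⁻¹ + 1) * ((M : ℝ)⁻¹ * ∑ i, ‖x - y i‖) := by
  set p : Tup d M := WithLp.toLp 2 (Sum.elim (fun _ => 0) (Sum.elim
    (fun i => (M : ℝ)⁻¹ • (f' i (y i) - γ i - η⁻¹ • (x - y i)))
    (fun i => (M : ℝ)⁻¹ • (x - y i)))) with hp
  have hmem : p ∈ subdiffD η f' R x y γ :=
    ⟨_, hx, by simp only [hp, Sum.elim_inl]; module, fun i => rfl, fun i => rfl⟩
  have hnorm : ‖p‖ ≤ ∑ k, ‖p k‖ := by
    refine (sq_le_sq₀ (norm_nonneg _) (by positivity)).1 ?_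
    rw [PiLp.norm_sq_eq_of_L2]
    exact Finset.sum_sq_le_sq_sum_of_nonneg fun _ _ => norm_nonneg _
  refine (Metric.infDist_le_dist_of_mem hmem).trans ?_
  rw [dist_zero_left]
  refine hnorm.trans_eq ?_
  simp [hp, hγ, norm_smul, abs_of_pos hη, ← Finset.mul_sum]
  ring

lemma continuous_of_convexOn_univ {d : ℕ} {R : Vec d → ℝ} (hR : ConvexOn ℝ Set.univ R) :
    Continuous R :=
  continuousOn_univ.1 (hR.continuousOn isOpen_univ)

/-- Subgradients of a continuous function are stable under limits. -/
lemma mem_subgrad_of_tendsto {d : ℕ} {R : Vec d → ℝ} (hR : Continuous R) {x g : ℕ → Vec d}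
    {x₀ g₀ : Vec d} (hx : Tendsto x atTop (𝓝 x₀)) (hg : Tendsto g atTop (𝓝 g₀))
    (h : ∀ᶠ t in atTop, g t ∈ subgrad R (x t)) : g₀ ∈ subgrad R x₀ := fun y =>
  le_of_tendsto (((hR.tendsto _).comp hx).add (hg.inner (tendsto_const_nhds.sub hx)))
    (h.mono fun _ ht => ht y)

theorem fedslr_global_convergence
    (d M : ℕ) (hd : 1 ≤ d) (hM : 1 ≤ M)
    (L ηg : ℝ) (hL : 0 < L) (hηg : 0 < ηg)
    (f : Fin M → Vec d → ℝ) (f' : Fin M → Vec d → Vec d)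
    (hgrad : ∀ i x, HasGradientAt (f i) (f' i x) x)
    (hlip : ∀ i (x y : Vec d), ‖f' i x - f' i y‖ ≤ L * ‖x - y‖)
    (R : Vec d → ℝ) (hRconv : ConvexOn ℝ Set.univ R) (hRnn : ∀ x, 0 ≤ R x)
    (w : ℕ → Vec d) (wi γi : Fin M → ℕ → Vec d)
    (hloc : ∀ i t (v : Vec d),
      f i (wi i (t+1)) - ⟪γi i t, wi i (t+1)⟫ + (2*ηg)⁻¹ * ‖w t - wi i (t+1)‖^2
        ≤ f i v - ⟪γi i t, v⟫ + (2*ηg)⁻¹ * ‖w t - v‖^2)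
    (hdual : ∀ i t, γi i (t+1) = γi i t + ηg⁻¹ • (w t - wi i (t+1)))
    (hagg : ∀ t (v : Vec d), v ≠ w (t+1) →
      R (w (t+1)) + (M:ℝ)⁻¹ * ∑ i, ⟪γi i (t+1), w (t+1)⟫
          + (2*ηg)⁻¹ * ‖w (t+1) - (M:ℝ)⁻¹ • ∑ i, wi i (t+1)‖^2
        < R v + (M:ℝ)⁻¹ * ∑ i, ⟪γi i (t+1), v⟫
          + (2*ηg)⁻¹ * ‖v - (M:ℝ)⁻¹ • ∑ i, wi i (t+1)‖^2)
    (hηg' : ηg < 1 / (2 * L))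
    (B : ℝ) (hB : 0 < B) (hBgrad : ∀ i x, ‖f' i x‖ ≤ B)
    (flow : ℝ) (hflow : ∀ i x, flow ≤ f i x)
    (ts : ℕ → ℕ) (hts : StrictMono ts) (hts1 : 1 ≤ ts 0)
    (wst : Vec d) (wist γist : Fin M → Vec d)
    (hclw : Tendsto (fun j => w (ts j)) atTop (𝓝 wst))
    (hclwi : ∀ i, Tendsto (fun j => wi i (ts j)) atTop (𝓝 (wist i)))
    (hclγ : ∀ i, Tendsto (fun j => γi i (ts j)) atTop (𝓝 (γist i)))
    (θ c : ℝ) (hθ : 0 ≤ θ) (hθ' : θ < 1) (hc : 0 < c)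
    (hKL : ∀ t, 1 ≤ t →
      0 < (potD ηg f R (w t) (fun i => wi i t) (fun i => γi i t) - potD ηg f R wst wist γist) →
      (potD ηg f R (w t) (fun i => wi i t) (fun i => γi i t) - potD ηg f R wst wist γist) ^ θ
        ≤ c * (1 - θ) *
          Metric.infDist (0 : Tup d M) (subdiffD ηg f' R (w t) (fun i => wi i t) (fun i => γi i t)))
 :
    Summable (fun t : ℕ => (M:ℝ)⁻¹ * ∑ i, ‖wi i t - wi i (t+1)‖) ∧
    (∀ i, Tendsto (fun t => wi i t) atTop (𝓝 (wist i))) ∧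
    Tendsto w atTop (𝓝 wst) ∧
    -((M:ℝ)⁻¹ • ∑ i, f' i wst) ∈ subgrad R wst := by
  have hM0 : (0 : ℝ) < M := by exact_mod_cast hM
  have hopt : ∀ i t, f' i (wi i (t + 1)) = γi i (t + 1) := fun i t => by
    rw [hdual]
    exact gradient_eq_of_forall_prox_le (hgrad i) (hlip i) (hloc i t)
  have haggle : ∀ t v, R (w (t+1)) + (M:ℝ)⁻¹ * ∑ i, ⟪γi i (t+1), w (t+1)⟫
          + (2*ηg)⁻¹ * ‖w (t+1) - (M:ℝ)⁻¹ • ∑ i, wi i (t+1)‖^2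
        ≤ R v + (M:ℝ)⁻¹ * ∑ i, ⟪γi i (t+1), v⟫
          + (2*ηg)⁻¹ * ‖v - (M:ℝ)⁻¹ • ∑ i, wi i (t+1)‖^2 := by
    intro t v
    rcases eq_or_ne v (w (t + 1)) with rfl | hv
    · exact le_rfl
    · exact (hagg t v hv).le
  have hsub : ∀ t, -((M : ℝ)⁻¹ • ∑ i, γi i (t + 1)
      + (ηg * M)⁻¹ • ∑ i, (w (t + 1) - wi i (t + 1))) ∈ subgrad R (w (t + 1)) := by
    intro t
    have h := neg_mem_subgrad_of_forall_prox_le hRconv (η := ηg)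
      (a := (M : ℝ)⁻¹ • ∑ i, γi i (t + 1)) (b := (M : ℝ)⁻¹ • ∑ i, wi i (t + 1))
      (x := w (t + 1)) (fun v => by
        simpa only [real_inner_smul_left, sum_inner, norm_sub_rev] using haggle t v)
    convert h using 3
    rw [Finset.sum_sub_distrib, Finset.sum_const, Finset.card_univ, Fintype.card_fin,
      ← Nat.cast_smul_eq_nsmul ℝ, smul_sub, smul_smul, smul_sub, smul_smul]
    congr 2 <;> field_simp
  have hγstep : ∀ i t, ‖w (t + 1) - wi i (t + 2)‖ ≤ ηg * L * ‖wi i (t + 1) - wi i (t + 2)‖ := by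
    intro i t
    have h : w (t + 1) - wi i (t + 2) = ηg • (f' i (wi i (t + 2)) - f' i (wi i (t + 1))) := by
      rw [hopt, hopt, hdual i (t + 1), add_sub_cancel_left, smul_smul, mul_inv_cancel₀ hηg.ne',
        one_smul]
    rw [h, norm_smul, Real.norm_of_nonneg hηg.le, mul_assoc, norm_sub_rev (wi i (t + 1))]
    gcongr
    exact hlip i _ _
  have hdisagree : ∀ i t, ‖w (t + 1) - wi i (t + 1)‖
      ≤ (1 + ηg * L) * ‖wi i (t + 1) - wi i (t + 2)‖ := by
    intro i t
    have h := norm_sub_le_norm_sub_add_norm_sub (w (t + 1)) (wi i (t + 2)) (wi i (t + 1))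
    rw [norm_sub_rev (wi i (t + 2))] at h
    linarith [hγstep i t]
  set D : ℕ → ℝ := fun t => potD ηg f R (w t) (fun i => wi i t) (fun i => γi i t) with hD
  set a : ℕ → ℝ := fun t => (M : ℝ)⁻¹ * ∑ i, ‖wi i t - wi i (t + 1)‖ with ha
  have ha0 : ∀ t, 0 ≤ a t := fun t => by positivity
  set σ : ℝ := (2 * ηg)⁻¹ - L / 2 - ηg * L ^ 2 with hσdef
  have hσ : 0 < σ := by
    have h1 : ηg * L < 1 / 2 := by
      rw [lt_div_iff₀ (by positivity)] at hηg'
      linarith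
    have h2 : σ = (2 * ηg)⁻¹ * ((1 - 2 * (ηg * L)) * (1 + ηg * L)) := by
      rw [hσdef]
      field_simp
      ring
    rw [h2]
    have : 0 < 1 - 2 * (ηg * L) := by linarith
    positivity
  have hdescent : ∀ t, D (t + 2) + σ * a (t + 1) ^ 2 ≤ D (t + 1) := by
    intro t
    have hclient : ∀ i, f i (wi i (t + 2)) + ⟪γi i (t + 2), w (t + 1) - wi i (t + 2)⟫
          + (2 * ηg)⁻¹ * ‖w (t + 1) - wi i (t + 2)‖ ^ 2
          + σ * ‖wi i (t + 1) - wi i (t + 2)‖ ^ 2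
        ≤ f i (wi i (t + 1)) + ⟪γi i (t + 1), w (t + 1) - wi i (t + 1)⟫
          + (2 * ηg)⁻¹ * ‖w (t + 1) - wi i (t + 1)‖ ^ 2 := by
      intro i
      have h1 := prox_add_sq_le (hgrad i) (hlip i) ((hopt i (t + 1)).trans (hdual i (t + 1)))
        (wi i (t + 1))
      have h2 : ⟪γi i (t + 2), w (t + 1) - wi i (t + 2)⟫
          = ⟪γi i (t + 1), w (t + 1) - wi i (t + 2)⟫ + ηg⁻¹ * ‖w (t + 1) - wi i (t + 2)‖ ^ 2 := by
        rw [hdual i (t + 1), inner_add_left, real_inner_smul_left, real_inner_self_eq_norm_sq]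
      have h3 : ηg⁻¹ * ‖w (t + 1) - wi i (t + 2)‖ ^ 2
          ≤ ηg * L ^ 2 * ‖wi i (t + 1) - wi i (t + 2)‖ ^ 2 := by
        rw [inv_mul_le_iff₀ hηg]
        refine (pow_le_pow_left₀ (norm_nonneg _) (hγstep i t) 2).trans_eq ?_
        ring
      rw [h2, hσdef]
      linarith
    have hserver : D (t + 2) ≤ potD ηg f R (w (t + 1)) (fun i => wi i (t + 2))
        (fun i => γi i (t + 2)) := potD_le_of_prox_le hM f (haggle (t + 1) (w (t + 1)))
    have hjensen : a (t + 1) ^ 2 ≤ (M : ℝ)⁻¹ * ∑ i, ‖wi i (t + 1) - wi i (t + 2)‖ ^ 2 := by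
      have h := sq_sum_le_card_mul_sum_sq (s := Finset.univ)
        (f := fun i => ‖wi i (t + 1) - wi i (t + 2)‖)
      rw [Finset.card_univ, Fintype.card_fin] at h
      rw [ha, mul_pow, sq (M : ℝ)⁻¹, mul_assoc]
      gcongr
      rwa [inv_mul_le_iff₀ hM0]
    have hsum := mul_le_mul_of_nonneg_left
      (Finset.sum_le_sum fun i (_ : i ∈ Finset.univ) => hclient i) (inv_nonneg.2 hM0.le)
    rw [Finset.sum_add_distrib, ← Finset.mul_sum] at hsum
    rw [potD_eq] at hserver
    have hD1 : D (t + 1) = _ := potD_eq ηg f R _ _ _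
    have := mul_le_mul_of_nonneg_left hjensen hσ.le
    rw [hD1]
    linarith
  have hRcont := continuous_of_convexOn_univ hRconv
  have hcluster : Tendsto (fun j => D (ts j)) atTop (𝓝 (potD ηg f R wst wist γist)) := by
    have hf : ∀ i, Tendsto (fun j => f i (wi i (ts j))) atTop (𝓝 (f i (wist i))) := fun i =>
      (hgrad i _).continuousAt.tendsto.comp (hclwi i)
    have hdiff : ∀ i, Tendsto (fun j => w (ts j) - wi i (ts j)) atTop (𝓝 (wst - wist i)) :=
      fun i => hclw.sub (hclwi i)
    simp only [hD, potD]
    exact ((((tendsto_finsetSum _ fun i _ => hf i).const_mul _).add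
      ((hRcont.tendsto _).comp hclw)).add
      ((tendsto_finsetSum _ fun i _ => (hclγ i).inner (hdiff i)).const_mul _)).add
      ((tendsto_finsetSum _ fun i _ => ((hdiff i).norm.pow 2).const_mul _).const_mul _)
  have hanti : Antitone fun t => D (t + 1) := antitone_nat_of_succ_le fun t =>
    (le_add_of_nonneg_right (by positivity)).trans (hdescent t)
  have hres : ∀ t, 0 ≤ D (t + 1) - potD ηg f R wst wist γist := by
    intro t
    refine sub_nonneg.2 (le_of_tendsto hcluster ?_)
    filter_upwards [hts.tendsto_atTop.eventually_ge_atTop (t + 1)] with j hj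
    obtain ⟨k, hk⟩ := Nat.exists_eq_add_of_le' ((Nat.le_add_left 1 t).trans hj)
    rw [hk]
    exact hanti (by omega)
  have hsummable : Summable a := by
    rw [← summable_nat_add_iff 1]
    refine summable_of_sq_descent_of_kl (K := c * ((ηg⁻¹ + 1) * (1 + ηg * L))) hθ hθ' hσ
      (by positivity) (fun t => ha0 _) hres (fun t => by linarith [hdescent t]) fun t ht => ?_
    have hp : 0 < 1 - θ := sub_pos.2 hθ'
    calc _ ≤ c * (1 - θ) * _ := hKL (t + 1) (Nat.le_add_left 1 t) ht
      _ ≤ c * (1 - θ) * ((ηg⁻¹ + 1) * ((M : ℝ)⁻¹ * ∑ i, ‖w (t + 1) - wi i (t + 1)‖)) := by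
          gcongr
          exact infDist_subdiffD_le hηg (fun i => hopt i t) (hsub t)
      _ ≤ c * (1 - θ) * ((ηg⁻¹ + 1) * ((M : ℝ)⁻¹
            * ∑ i, (1 + ηg * L) * ‖wi i (t + 1) - wi i (t + 2)‖)) := by
          gcongr with i
          exact hdisagree i t
      _ = _ := by
          rw [ha, ← Finset.mul_sum]
          ring
  have hstep : ∀ i t, ‖wi i t - wi i (t + 1)‖ ≤ M * a t := by
    intro i t
    rw [ha, mul_inv_cancel_left₀ hM0.ne']
    exact Finset.single_le_sum (f := fun i => ‖wi i t - wi i (t + 1)‖)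
      (fun _ _ => norm_nonneg _) (Finset.mem_univ i)
  have hwi : ∀ i, Tendsto (fun t => wi i t) atTop (𝓝 (wist i)) := fun i =>
    tendsto_nhds_of_cauchySeq_of_subseq
      (cauchySeq_of_dist_le_of_summable _ (fun t => by rw [dist_eq_norm]; exact hstep i t)
        (hsummable.mul_left (M : ℝ)))
      hts.tendsto_atTop (hclwi i)
  have hgap : ∀ i, Tendsto (fun t => w (t + 1) - wi i (t + 1)) atTop (𝓝 0) := by
    intro i
    refine squeeze_zero_norm (a := fun t => (1 + ηg * L) * (M * a (t + 1))) (fun t => ?_) ?_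
    · exact (hdisagree i t).trans (by gcongr; exact hstep i (t + 1))
    · simpa using ((hsummable.tendsto_atTop_zero.comp (tendsto_add_atTop_nat 1)).const_mul
        (M : ℝ)).const_mul (1 + ηg * L)
  have hwi' : ∀ i, Tendsto (fun t => wi i (t + 1)) atTop (𝓝 (wist i)) := fun i =>
    (hwi i).comp (tendsto_add_atTop_nat 1)
  have hwlim : ∀ i, Tendsto w atTop (𝓝 (wist i)) := fun i => by
    rw [← tendsto_add_atTop_iff_nat 1]
    simpa using (hgap i).add (hwi' i)
  have hwist : ∀ i, wist i = wst := fun i =>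
    tendsto_nhds_unique ((hwlim i).comp hts.tendsto_atTop) hclw
  have hw : Tendsto w atTop (𝓝 wst) := hwist ⟨0, hM⟩ ▸ hwlim ⟨0, hM⟩
  refine ⟨hsummable, hwi, hw, ?_⟩
  have hγlim : ∀ i, Tendsto (fun t => γi i (t + 1)) atTop (𝓝 (f' i wst)) := by
    intro i
    have hcont : Continuous (f' i) :=
      (LipschitzWith.of_dist_le_mul (K := ⟨L, hL.le⟩) fun x y => by
        rw [dist_eq_norm, dist_eq_norm]
        exact hlip i x y).continuous
    simpa only [Function.comp_def, hopt, hwist] using (hcont.tendsto _).comp (hwi' i)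
  have hlim := (((tendsto_finsetSum Finset.univ fun i _ => hγlim i).const_smul (M : ℝ)⁻¹).add
    ((tendsto_finsetSum Finset.univ fun i _ => hgap i).const_smul (ηg * M)⁻¹)).neg
  rw [Finset.sum_const_zero, smul_zero, add_zero] at hlim
  exact mem_subgrad_of_tendsto hRcont (hw.comp (tendsto_add_atTop_nat 1)) hlim
    (Eventually.of_forall hsub)
end
end

section
/- Sufficient and non-increasing descent of the potential function (Lemma: sufficient descent). Under the FedSLR setup, for every t ≥ 1: D_{t+1} − D_t ≤ (1/M) Σ_{i=1}^M [ (L²η_g + L/2 − 1/(2η_g)) ‖w_{i,t+1} − w_{i,t}‖² − (1/(2η_g)) ‖w_{t+1} − w_t‖² ]. Moreover, if in addition 0 < η_g ≤ 1/(2L), then D_{t+1} ≤ D_t for all t ≥ 1. -/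
open Filter Topology Finset MeasureTheory RealInnerProductSpace

noncomputable section

section Lemmas

variable {E : Type*} [NormedAddCommGroup E] [InnerProductSpace ℝ E]

/-- A function with `L`-Lipschitz gradient lies above its quadratic lower model. -/
lemma quadratic_lower_bound_of_lipschitz_gradient [CompleteSpace E] {f : E → ℝ} {f' : E → E}
    {L : ℝ} (hgrad : ∀ x, HasGradientAt f (f' x) x)
    (hlip : ∀ x y, ‖f' x - f' y‖ ≤ L * ‖x - y‖) (x y : E) :
    f x + ⟪f' x, y - x⟫ - L / 2 * ‖y - x‖ ^ 2 ≤ f y := by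
  set v := y - x with hv
  let g : ℝ → ℝ := fun s => f (x + s • v) - s * ⟪f' x, v⟫ + s ^ 2 * (L / 2 * ‖v‖ ^ 2)
  have hg : ∀ s : ℝ, HasDerivAt g
      (⟪f' (x + s • v), v⟫ - ⟪f' x, v⟫ + 2 * s * (L / 2 * ‖v‖ ^ 2)) s := by
    intro s
    have hline : HasDerivAt (fun s : ℝ => x + s • v) v s := by
      simpa using ((hasDerivAt_id s).smul_const v).const_add x
    have hf := (hgrad (x + s • v)).hasFDerivAt.comp_hasDerivAt s hline
    have hlin := (hasDerivAt_id s).mul_const ⟪f' x, v⟫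
    have hsq := (hasDerivAt_pow 2 s).mul_const (L / 2 * ‖v‖ ^ 2)
    exact ((hf.sub hlin).add hsq).congr_deriv (by simp)
  have hmono : MonotoneOn g (Set.Ici 0) := by
    refine monotoneOn_of_deriv_nonneg (convex_Ici 0)
      (fun s _ => (hg s).continuousAt.continuousWithinAt)
      (fun s _ => (hg s).differentiableAt.differentiableWithinAt) fun s hs => ?_
    rw [interior_Ici, Set.mem_Ioi] at hs
    rw [(hg s).deriv, ← inner_sub_left]
    have h1 := neg_le_of_abs_le (abs_real_inner_le_norm (f' (x + s • v) - f' x) v)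
    have h2 := hlip (x + s • v) x
    rw [add_sub_cancel_left, norm_smul, Real.norm_of_nonneg hs.le] at h2
    have h3 := mul_le_mul_of_nonneg_right h2 (norm_nonneg v)
    nlinarith
  have h01 := hmono (Set.mem_Ici.2 le_rfl) (Set.mem_Ici.2 zero_le_one) zero_le_one
  simp only [g, zero_smul, one_smul, add_zero, hv, add_sub_cancel] at h01
  rw [← hv] at h01
  linarith

/-- First-order optimality condition for a proximal step with a linear perturbation. -/
lemma gradient_eq_of_prox_minimizer [CompleteSpace E] {f : E → ℝ} {f' γ x z : E} {η : ℝ}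
    (hgrad : HasGradientAt f f' z)
    (hmin : ∀ v, f z - ⟪γ, z⟫ + (2 * η)⁻¹ * ‖x - z‖ ^ 2
      ≤ f v - ⟪γ, v⟫ + (2 * η)⁻¹ * ‖x - v‖ ^ 2) :
    f' = γ + η⁻¹ • (x - z) := by
  refine ext_inner_right ℝ fun h => ?_
  have hline : HasDerivAt (fun s : ℝ => z + s • h) h 0 := by
    simpa using ((hasDerivAt_id (0 : ℝ)).smul_const h).const_add z
  have hf : HasDerivAt (fun s : ℝ => f (z + s • h)) ⟪f', h⟫ 0 := by
    have hgrad' : HasGradientAt f f' (z + (0 : ℝ) • h) := by simpa using hgrad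
    exact (hgrad'.hasFDerivAt.comp_hasDerivAt (0 : ℝ) hline).congr_deriv (by simp)
  have hlin := (hasDerivAt_const (0 : ℝ) γ).inner ℝ hline
  have hsq := ((hline.const_sub x).norm_sq).const_mul (2 * η)⁻¹
  have hzero := IsLocalMin.hasDerivAt_eq_zero
    (f := fun s : ℝ => f (z + s • h) - ⟪γ, z + s • h⟫ + (2 * η)⁻¹ * ‖x - (z + s • h)‖ ^ 2)
    (Filter.Eventually.of_forall fun s => by simpa using hmin (z + s • h))
    ((hf.sub hlin).add hsq)
  simp only [zero_smul, add_zero, inner_zero_left, inner_neg_right, mul_inv] at hzero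
  rw [inner_add_left, real_inner_smul_left]
  linarith

/-- Quadratic growth of a convex function plus an affine and a squared-distance term at a
minimizer. -/
lemma quadratic_growth_of_prox_minimizer {R : E → ℝ} (hR : ConvexOn ℝ Set.univ R) {g c z : E}
    {a : ℝ}
    (hmin : ∀ v, R z + ⟪g, z⟫ + a * ‖z - c‖ ^ 2 ≤ R v + ⟪g, v⟫ + a * ‖v - c‖ ^ 2) (x : E) :
    R z + ⟪g, z⟫ + a * ‖z - c‖ ^ 2 + a * ‖x - z‖ ^ 2 ≤ R x + ⟪g, x⟫ + a * ‖x - c‖ ^ 2 := by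
  have hxc : ‖x - c‖ ^ 2 = ‖z - c‖ ^ 2 + 2 * ⟪z - c, x - z⟫ + ‖x - z‖ ^ 2 := by
    rw [← norm_add_sq_real, sub_add_sub_comm, add_comm z x, add_comm c z, add_sub_add_comm]
    congr 2; abel
  have hgx : ⟪g, x⟫ = ⟪g, z⟫ + ⟪g, x - z⟫ := by rw [inner_sub_right]; ring
  rw [hxc, hgx]
  set A := R x - R z + ⟪g, x - z⟫ + 2 * a * ⟪z - c, x - z⟫ with hA
  have hstep : ∀ s ∈ Set.Ioo (0 : ℝ) 1, 0 ≤ A + s * (a * ‖x - z‖ ^ 2) := by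
    rintro s ⟨hs0, hs1⟩
    have hconv := hR.2 (Set.mem_univ z) (Set.mem_univ x) (sub_nonneg.2 hs1.le) hs0.le
      (sub_add_cancel 1 s)
    have hm := hmin (z + s • (x - z))
    have hv : (1 - s) • z + s • x = z + s • (x - z) := by module
    have hn : ‖z + s • (x - z) - c‖ ^ 2
        = ‖z - c‖ ^ 2 + 2 * (s * ⟪z - c, x - z⟫) + s ^ 2 * ‖x - z‖ ^ 2 := by
      rw [add_sub_right_comm, norm_add_sq_real, real_inner_smul_right, norm_smul, mul_pow,
        Real.norm_eq_abs, sq_abs]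
    rw [hv, smul_eq_mul, smul_eq_mul] at hconv
    rw [hn, inner_add_right, real_inner_smul_right] at hm
    refine nonneg_of_mul_nonneg_right (b := A + s * (a * ‖x - z‖ ^ 2)) (a := s) ?_ hs0
    rw [hA]
    linarith
  have hlim : Tendsto (fun s : ℝ => A + s * (a * ‖x - z‖ ^ 2)) (𝓝[>] 0) (𝓝 A) := by
    have : Continuous fun s : ℝ => A + s * (a * ‖x - z‖ ^ 2) := by fun_prop
    simpa using (this.tendsto 0).mono_left nhdsWithin_le_nhds
  have hA0 : 0 ≤ A :=
    ge_of_tendsto hlim (eventually_of_mem (Ioo_mem_nhdsGT zero_lt_one) hstep)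
  linarith

/-- Decomposition of an average of squared distances around the mean. -/
lemma average_norm_sub_sq {M : ℕ} (hM : 1 ≤ M) (y : Fin M → E) (x : E) :
    (M : ℝ)⁻¹ * ∑ i, ‖x - y i‖ ^ 2
      = ‖x - (M : ℝ)⁻¹ • ∑ i, y i‖ ^ 2
        + ((M : ℝ)⁻¹ * ∑ i, ‖y i‖ ^ 2 - ‖(M : ℝ)⁻¹ • ∑ i, y i‖ ^ 2) := by
  have hM0 : (M : ℝ) ≠ 0 := by positivity
  simp only [norm_sub_sq_real, sum_add_distrib, sum_sub_distrib, ← mul_sum, ← inner_sum,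
    real_inner_smul_right, sum_const, card_univ, Fintype.card_fin, nsmul_eq_mul]
  field_simp
  ring

/-- Effect of a local primal step and its dual step on the augmented Lagrangian. -/
lemma local_augmented_lagrangian_descent [CompleteSpace E] {f : E → ℝ} {f' : E → E} {L η : ℝ}
    (hη : 0 < η) (hgrad : ∀ x, HasGradientAt f (f' x) x)
    (hlip : ∀ x y, ‖f' x - f' y‖ ≤ L * ‖x - y‖) {x y z : E}
    (hdual : f' z = f' y + η⁻¹ • (x - z)) :
    f z + ⟪f' z, x - z⟫ + (2 * η)⁻¹ * ‖x - z‖ ^ 2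
      ≤ f y + ⟪f' y, x - y⟫ + (2 * η)⁻¹ * ‖x - y‖ ^ 2
        + (L ^ 2 * η + L / 2 - (2 * η)⁻¹) * ‖z - y‖ ^ 2 := by
  have hlow := quadratic_lower_bound_of_lipschitz_gradient hgrad hlip z y
  rw [← neg_sub z y, inner_neg_right, norm_neg] at hlow
  have hxz : x - z = η • (f' z - f' y) := by
    rw [hdual, add_sub_cancel_left, smul_inv_smul₀ hη.ne']
  have hxy : x - y = η • (f' z - f' y) + (z - y) := by rw [← hxz]; abel
  have hsq : ‖f' z - f' y‖ ^ 2 ≤ L ^ 2 * ‖z - y‖ ^ 2 := by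
    rw [← mul_pow]
    exact pow_le_pow_left₀ (norm_nonneg _) (hlip z y) 2
  have hηsq := mul_le_mul_of_nonneg_left hsq hη.le
  have hself := real_inner_self_eq_norm_sq (f' z - f' y)
  have hnorm := norm_add_sq_real (η • (f' z - f' y)) (z - y)
  rw [real_inner_smul_left, inner_sub_left] at hnorm
  rw [inner_sub_left] at hself
  have hcancel : (2 * η)⁻¹ * (2 * (η * (⟪f' z, z - y⟫ - ⟪f' y, z - y⟫)))
      = ⟪f' z, z - y⟫ - ⟪f' y, z - y⟫ := by field_simp
  rw [hxy, hxz, hnorm, inner_add_right, real_inner_smul_right, real_inner_smul_right]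
  nlinarith

end Lemmas

theorem fedslr_sufficient_descent
    (d M : ℕ) (hd : 1 ≤ d) (hM : 1 ≤ M)
    (L ηg : ℝ) (hL : 0 < L) (hηg : 0 < ηg)
    (f : Fin M → Vec d → ℝ) (f' : Fin M → Vec d → Vec d)
    (hgrad : ∀ i x, HasGradientAt (f i) (f' i x) x)
    (hlip : ∀ i (x y : Vec d), ‖f' i x - f' i y‖ ≤ L * ‖x - y‖)
    (R : Vec d → ℝ) (hRconv : ConvexOn ℝ Set.univ R) (hRnn : ∀ x, 0 ≤ R x)
    (w : ℕ → Vec d) (wi γi : Fin M → ℕ → Vec d)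
    (hloc : ∀ i t (v : Vec d),
      f i (wi i (t+1)) - ⟪γi i t, wi i (t+1)⟫ + (2*ηg)⁻¹ * ‖w t - wi i (t+1)‖^2
        ≤ f i v - ⟪γi i t, v⟫ + (2*ηg)⁻¹ * ‖w t - v‖^2)
    (hdual : ∀ i t, γi i (t+1) = γi i t + ηg⁻¹ • (w t - wi i (t+1)))
    (hagg : ∀ t (v : Vec d), v ≠ w (t+1) →
      R (w (t+1)) + (M:ℝ)⁻¹ * ∑ i, ⟪γi i (t+1), w (t+1)⟫
          + (2*ηg)⁻¹ * ‖w (t+1) - (M:ℝ)⁻¹ • ∑ i, wi i (t+1)‖^2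
        < R v + (M:ℝ)⁻¹ * ∑ i, ⟪γi i (t+1), v⟫
          + (2*ηg)⁻¹ * ‖v - (M:ℝ)⁻¹ • ∑ i, wi i (t+1)‖^2)
 :
    (∀ t : ℕ, 1 ≤ t →
      potD ηg f R (w (t+1)) (fun i => wi i (t+1)) (fun i => γi i (t+1))
          - potD ηg f R (w t) (fun i => wi i t) (fun i => γi i t)
        ≤ (M:ℝ)⁻¹ * ∑ i, ((L^2 * ηg + L/2 - (2*ηg)⁻¹) * ‖wi i (t+1) - wi i t‖^2
            - (2*ηg)⁻¹ * ‖w (t+1) - w t‖^2)) ∧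
    (ηg ≤ 1 / (2*L) → ∀ t : ℕ, 1 ≤ t →
      potD ηg f R (w (t+1)) (fun i => wi i (t+1)) (fun i => γi i (t+1))
        ≤ potD ηg f R (w t) (fun i => wi i t) (fun i => γi i t)) := by
  have hγ : ∀ i t, γi i (t + 1) = f' i (wi i (t + 1)) := fun i t =>
    (hdual i t).trans (gradient_eq_of_prox_minimizer (hgrad i _) (hloc i t)).symm
  have hM0 : (M : ℝ) ≠ 0 := by positivity
  have hMinv : 0 ≤ (M : ℝ)⁻¹ := by positivity
  have hdescent : ∀ t : ℕ, 1 ≤ t →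
      potD ηg f R (w (t+1)) (fun i => wi i (t+1)) (fun i => γi i (t+1))
          - potD ηg f R (w t) (fun i => wi i t) (fun i => γi i t)
        ≤ (M:ℝ)⁻¹ * ∑ i, ((L^2 * ηg + L/2 - (2*ηg)⁻¹) * ‖wi i (t+1) - wi i t‖^2
            - (2*ηg)⁻¹ * ‖w (t+1) - w t‖^2) := by
    intro t ht
    obtain ⟨k, rfl⟩ : ∃ k, t = k + 1 := ⟨t - 1, by omega⟩
    have hlocal := mul_le_mul_of_nonneg_left (sum_le_sum fun i (_ : i ∈ univ) =>
      local_augmented_lagrangian_descent hηg (hgrad i) (hlip i)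
        (x := w (k + 1)) (y := wi i (k + 1)) (z := wi i (k + 1 + 1))
        (by rw [← hγ, ← hγ]; exact hdual i (k + 1))) hMinv
    have hserver := quadratic_growth_of_prox_minimizer hRconv
      (g := (M : ℝ)⁻¹ • ∑ i, γi i (k + 1 + 1)) (z := w (k + 1 + 1))
      (c := (M : ℝ)⁻¹ • ∑ i, wi i (k + 1 + 1)) (a := (2 * ηg)⁻¹)
      (fun v => by
        rcases eq_or_ne v (w (k + 1 + 1)) with rfl | hv
        · exact le_rfl
        · simpa only [real_inner_smul_left, sum_inner] using (hagg (k + 1) v hv).le)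
      (w (k + 1))
    have hold := average_norm_sub_sq hM (fun i => wi i (k + 1 + 1)) (w (k + 1))
    have hnew := average_norm_sub_sq hM (fun i => wi i (k + 1 + 1)) (w (k + 1 + 1))
    rw [← sub_eq_iff_eq_add] at hold hnew
    rw [← hold, ← hnew, norm_sub_rev (w (k + 1)), real_inner_smul_left, real_inner_smul_left,
      sum_inner, sum_inner] at hserver
    simp only [potD, ← hγ, inner_sub_right, sum_add_distrib, sum_sub_distrib, ← mul_sum,
      sum_const, card_univ, Fintype.card_fin, nsmul_eq_mul] at hlocal hserver ⊢
    have hmean : (M : ℝ)⁻¹ * ((2 * ηg)⁻¹ * (M * ‖w (k + 1 + 1) - w (k + 1)‖ ^ 2))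
        = (2 * ηg)⁻¹ * ‖w (k + 1 + 1) - w (k + 1)‖ ^ 2 := by field_simp
    rw [mul_sub (M : ℝ)⁻¹ (_ * ∑ i, ‖wi i (k + 1 + 1) - wi i (k + 1)‖ ^ 2), hmean]
    linarith
  refine ⟨hdescent, fun hη t ht => ?_⟩
  have hηL : ηg * L ≤ 1 / 2 := by
    rw [le_div_iff₀ (by positivity)] at hη
    linarith
  have hcoef : L ^ 2 * ηg + L / 2 - (2 * ηg)⁻¹ ≤ 0 := by
    rw [sub_nonpos, ← one_div, le_div_iff₀ (by positivity)]
    nlinarith [mul_pos hηg hL]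
  have hrhs : (M:ℝ)⁻¹ * ∑ i, ((L^2 * ηg + L/2 - (2*ηg)⁻¹) * ‖wi i (t+1) - wi i t‖^2
      - (2*ηg)⁻¹ * ‖w (t+1) - w t‖^2) ≤ 0 := by
    refine mul_nonpos_of_nonneg_of_nonpos hMinv (sum_nonpos fun i _ => ?_)
    have h1 := mul_nonpos_of_nonpos_of_nonneg hcoef (sq_nonneg ‖wi i (t+1) - wi i t‖)
    have h2 : 0 ≤ (2*ηg)⁻¹ * ‖w (t+1) - w t‖^2 := by positivity
    linarith
  linarith [hdescent t ht]
end
end
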